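/- arXiv:0711.1319 — 4 statements merged into one kernel-verified Lean document; each statement's English description precedes it below -/
import Mathlib

section
/- Let X be a right A-Galois object, φ_X the functional on X determined by (id ⊗ φ)(α(x)) = φ_X(x)·1, and ψ_X a nonzero invariant functional on X. Then there exists a unique invertible element δ_X ∈ X such that φ_X(x·δ_X) = ψ_X(x) for all x ∈ X. -/
open TensorProduct

noncomputable section

variable (k : Type*) [Field k]

/-- Apply a linear functional to the second tensor factor. -/
def applySnd {M N : Type*} [AddCommGroup M] [Module k M]
    [AddCommGroup N] [Module k N] (f : N →ₗ[k] k) : M ⊗[k] N →ₗ[k] M :=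
  (TensorProduct.rid k M).toLinearMap ∘ₗ LinearMap.lTensor M f

/-- Apply a linear functional to the first tensor factor. -/
def applyFst {M N : Type*} [AddCommGroup M] [Module k M]
    [AddCommGroup N] [Module k N] (f : M →ₗ[k] k) : M ⊗[k] N →ₗ[k] N :=
  (TensorProduct.lid k N).toLinearMap ∘ₗ LinearMap.rTensor N f

variable (A X : Type*) [Ring A] [HopfAlgebra k A] [Ring X] [Algebra k X]

/-- The Galois map `V : X ⊗ X → X ⊗ A`, `x ⊗ y ↦ (x ⊗ 1) * α y`. -/
def galoisV (α : X →ₐ[k] X ⊗[k] A) : X ⊗[k] X →ₗ[k] X ⊗[k] A :=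
  LinearMap.mul' k (X ⊗[k] A) ∘ₗ
    TensorProduct.map ((TensorProduct.mk k X A).flip 1) α.toLinearMap

/-- A Hopf algebra with bijective antipode and faithful left integral `φ`,
together with a right Galois coaction `α` on `X` with trivial coinvariants. -/
structure GaloisContext where
  φ : A →ₗ[k] k
  φ_ne : φ ≠ 0
  φ_integral : ∀ a : A, applySnd k φ (Coalgebra.comul a) = φ a • (1 : A)
  φ_faithful_left : ∀ a : A, (∀ b : A, φ (a * b) = 0) → a = 0
  φ_faithful_right : ∀ a : A, (∀ b : A, φ (b * a) = 0) → a = 0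
  antipode_bijective : Function.Bijective (HopfAlgebra.antipode (R := k) (A := A))
  α : X →ₐ[k] X ⊗[k] A
  coassoc : ∀ x : X,
    TensorProduct.assoc k X A A ((LinearMap.rTensor A α.toLinearMap) (α x))
      = LinearMap.lTensor X (Coalgebra.comul (R := k) (A := A)) (α x)
  counit_id : ∀ x : X,
    applySnd k (Coalgebra.counit (R := k) (A := A)) (α x) = x
  coinv_trivial : ∀ x : X, α x = x ⊗ₜ[k] (1 : A) → ∃ c : k, x = c • (1 : X)
  galois : Function.Bijective (galoisV k A X α)

variable {k A X}

/-- The Galois map as a linear equivalence. -/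
def GaloisContext.V (G : GaloisContext k A X) : (X ⊗[k] X) ≃ₗ[k] (X ⊗[k] A) :=
  LinearEquiv.ofBijective (galoisV k A X G.α) G.galois

/-- The map `β : A → X ⊗ X`, `a ↦ V⁻¹(1 ⊗ a)`. -/
def GaloisContext.β (G : GaloisContext k A X) : A →ₗ[k] X ⊗[k] X :=
  G.V.symm.toLinearMap ∘ₗ TensorProduct.mk k X A 1

end

section Helpers

open TensorProduct Coalgebra HopfAlgebra

variable {k : Type*} [Field k] {A X : Type*} [Ring A] [HopfAlgebra k A] [Ring X] [Algebra k X]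

@[simp] lemma applySnd_tmul {M N : Type*} [AddCommGroup M] [Module k M]
    [AddCommGroup N] [Module k N] (f : N →ₗ[k] k) (m : M) (n : N) :
    applySnd k f (m ⊗ₜ[k] n) = f n • m := by
  simp [applySnd]

@[simp] lemma applyFst_tmul {M N : Type*} [AddCommGroup M] [Module k M]
    [AddCommGroup N] [Module k N] (f : M →ₗ[k] k) (m : M) (n : N) :
    applyFst k f (m ⊗ₜ[k] n) = f m • n := by
  simp [applyFst]

lemma apply_fst_snd {M N : Type*} [AddCommGroup M] [Module k M]
    [AddCommGroup N] [Module k N] (f : M →ₗ[k] k) (g : N →ₗ[k] k) (t : M ⊗[k] N) :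
    g (applyFst k f t) = f (applySnd k g t) := by
  induction t with
  | zero => simp
  | tmul x y => simp [mul_comm]
  | add x y hx hy => simp [hx, hy]

/-- `x ⊗ a ↦ α x * (1 ⊗ S a)` -/
def twistMap (α : X →ₐ[k] X ⊗[k] A) : X ⊗[k] A →ₗ[k] X ⊗[k] A :=
  LinearMap.mul' k (X ⊗[k] A) ∘ₗ
    TensorProduct.map α.toLinearMap (TensorProduct.mk k X A 1 ∘ₗ antipode k)

lemma twistMap_tmul (α : X →ₐ[k] X ⊗[k] A) (x : X) (a : A) :
    twistMap α (x ⊗ₜ a) = α x * (1 ⊗ₜ antipode k a) := by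
  simp [twistMap]

/-- `α x₀ (1 ⊗ S x₁) = x ⊗ 1` -/
lemma twistMap_coaction (α : X →ₐ[k] X ⊗[k] A)
    (hco : ∀ x : X, TensorProduct.assoc k X A A ((LinearMap.rTensor A α.toLinearMap) (α x))
      = LinearMap.lTensor X (comul (R := k) (A := A)) (α x))
    (hcu : ∀ x : X, applySnd k (counit (R := k) (A := A)) (α x) = x) (x : X) :
    twistMap α (α x) = x ⊗ₜ 1 := by
  have h1 : ∀ t : X ⊗[k] A, twistMap α t =
      LinearMap.lTensor X (LinearMap.mul' k A ∘ₗ LinearMap.lTensor A (antipode k))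
        (TensorProduct.assoc k X A A ((LinearMap.rTensor A α.toLinearMap) t)) := by
    intro t
    induction t with
    | zero => simp
    | add x y hx hy => simp only [map_add, hx, hy]
    | tmul x a =>
      rw [twistMap_tmul]
      simp only [LinearMap.rTensor_tmul, AlgHom.toLinearMap_apply]
      generalize α x = u
      induction u with
      | zero => simp
      | add x y hx hy => simp only [map_add, hx, hy, add_mul, TensorProduct.add_tmul]
      | tmul y b => simp
  have h2 : ∀ t : X ⊗[k] A,
      LinearMap.lTensor X (LinearMap.mul' k A ∘ₗ LinearMap.lTensor A (antipode k))
        (LinearMap.lTensor X (comul (R := k) (A := A)) t) =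
      (applySnd k (counit (R := k) (A := A)) t) ⊗ₜ 1 := by
    intro t
    induction t with
    | zero => simp
    | add x y hx hy => simp only [map_add, hx, hy, TensorProduct.add_tmul]
    | tmul x a =>
      simp [Algebra.algebraMap_eq_smul_one, TensorProduct.smul_tmul]
  rw [h1, hco, h2, hcu]

/-- Strong invariance, integrated. -/
lemma strong_invariance (α : X →ₐ[k] X ⊗[k] A)
    (hco : ∀ x : X, TensorProduct.assoc k X A A ((LinearMap.rTensor A α.toLinearMap) (α x))
      = LinearMap.lTensor X (comul (R := k) (A := A)) (α x))
    (hcu : ∀ x : X, applySnd k (counit (R := k) (A := A)) (α x) = x)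
    (φ : A →ₗ[k] k) (φX ψ : X →ₗ[k] k)
    (hφX : ∀ x : X, applySnd k φ (α x) = φX x • (1 : X))
    (hψ : ∀ x : X, applyFst k ψ (α x) = ψ x • (1 : A)) (x y : X) :
    ψ (y * applySnd k (φ ∘ₗ antipode k) (α x)) = φX y * ψ x := by
  have h1 : ∀ t : X ⊗[k] A, φ (applyFst k ψ (α y * twistMap α t)) =
      ψ (y * applySnd k (φ ∘ₗ antipode k) t) := by
    intro t
    induction t with
    | zero => simp
    | add x y hx hy => simp only [map_add, hx, hy, mul_add]
    | tmul x a =>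
      rw [twistMap_tmul, ← mul_assoc, ← map_mul]
      have h : ∀ u : X ⊗[k] A, applyFst k ψ (u * (1 ⊗ₜ antipode k a)) =
          applyFst k ψ u * antipode k a := by
        intro u
        induction u with
        | zero => simp
        | add x y hx hy => simp only [map_add, hx, hy, add_mul]
        | tmul y b => simp
      rw [h, hψ]
      simp [mul_comm]
  have h2 : ∀ u : X ⊗[k] A, applySnd k φ (u * (x ⊗ₜ 1)) = applySnd k φ u * x := by
    intro u
    induction u with
    | zero => simp
    | add x y hx hy => simp only [map_add, hx, hy, add_mul]
    | tmul y b => simp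
  rw [← h1, twistMap_coaction α hco hcu, apply_fst_snd, h2, hφX]
  simp

lemma coaction_E (α : X →ₐ[k] X ⊗[k] A)
    (hco : ∀ x : X, TensorProduct.assoc k X A A ((LinearMap.rTensor A α.toLinearMap) (α x))
      = LinearMap.lTensor X (comul (R := k) (A := A)) (α x))
    (θ : A →ₗ[k] k) (d : A) (hd : ∀ a : A, applySnd k θ (comul (R := k) a) = θ a • d) (x : X) :
    α (applySnd k θ (α x)) = (applySnd k θ (α x)) ⊗ₜ d := by
  have h1 : ∀ t : X ⊗[k] A, α (applySnd k θ t) =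
      LinearMap.lTensor X (applySnd k θ)
        (TensorProduct.assoc k X A A ((LinearMap.rTensor A α.toLinearMap) t)) := by
    intro t
    induction t with
    | zero => simp
    | add x y hx hy => simp only [map_add, hx, hy]
    | tmul x a =>
      simp only [LinearMap.rTensor_tmul, AlgHom.toLinearMap_apply, applySnd_tmul, map_smul]
      generalize α x = u
      induction u with
      | zero => simp
      | add x y hx hy => simp only [map_add, hx, hy, smul_add, TensorProduct.add_tmul]
      | tmul y b => simp
  have h2 : ∀ t : X ⊗[k] A, LinearMap.lTensor X (applySnd k θ)
      (LinearMap.lTensor X (comul (R := k) (A := A)) t) = (applySnd k θ t) ⊗ₜ d := by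
    intro t
    induction t with
    | zero => simp
    | add x y hx hy => simp only [map_add, hx, hy, TensorProduct.add_tmul]
    | tmul x a => simp [hd, TensorProduct.smul_tmul]
  rw [h1, hco, h2]

lemma comulAlg_coassoc (x : A) : TensorProduct.assoc k A A A
    ((LinearMap.rTensor A (Bialgebra.comulAlgHom k A).toLinearMap) (Bialgebra.comulAlgHom k A x))
      = LinearMap.lTensor A (comul (R := k) (A := A)) (Bialgebra.comulAlgHom k A x) :=
  Coalgebra.coassoc_apply x

lemma comulAlg_counit (x : A) :
    applySnd k (counit (R := k) (A := A)) (Bialgebra.comulAlgHom k A x) = x := by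
  simp [applySnd]

/-- `φ ∘ S` is right invariant. -/
lemma theta_invariant (φ : A →ₗ[k] k)
    (hφ : ∀ a : A, applySnd k φ (comul a) = φ a • (1 : A)) (a : A) :
    applyFst k (φ ∘ₗ antipode k) (Bialgebra.comulAlgHom k A a)
      = (φ ∘ₗ antipode k) a • (1 : A) := by
  let Δ := Bialgebra.comulAlgHom k A
  -- `a ⊗ u ↦ Δ (S a) * u`
  let P : A ⊗[k] (A ⊗[k] A) →ₗ[k] A ⊗[k] A :=
    LinearMap.mul' k (A ⊗[k] A) ∘ₗ LinearMap.rTensor (A ⊗[k] A) (Δ.toLinearMap ∘ₗ antipode k)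
  have hP : ∀ (a : A) (u : A ⊗[k] A), P (a ⊗ₜ u) = Δ (antipode k a) * u := by
    intro a u; simp [P]
  -- first evaluation
  have e1 : ∀ t : A ⊗[k] A, P (LinearMap.lTensor A (twistMap Δ)
      (LinearMap.lTensor A (comul (R := k) (A := A)) t)) =
      P (LinearMap.lTensor A ((TensorProduct.mk k A A).flip 1) t) := by
    intro t
    induction t with
    | zero => simp
    | add x y hx hy => simp only [map_add, hx, hy]
    | tmul x b =>
      simp only [LinearMap.lTensor_tmul, LinearMap.flip_apply, TensorProduct.mk_apply]
      have := twistMap_coaction Δ (comulAlg_coassoc) (comulAlg_counit) b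
      rw [← this]; rfl
  have e2 : ∀ t : A ⊗[k] A, P (LinearMap.lTensor A (twistMap Δ)
      (TensorProduct.assoc k A A A (LinearMap.rTensor A (comul (R := k) (A := A)) t))) =
      1 ⊗ₜ antipode k (applyFst k (counit (R := k) (A := A)) t) := by
    intro t
    induction t with
    | zero => simp
    | add x y hx hy => simp only [map_add, hx, hy, TensorProduct.tmul_add]
    | tmul x b =>
      have h : ∀ u : A ⊗[k] A, P (LinearMap.lTensor A (twistMap Δ)
          (TensorProduct.assoc k A A A (u ⊗ₜ b))) =
          Δ (LinearMap.mul' k A (LinearMap.rTensor A (antipode k) u)) *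
            (1 ⊗ₜ antipode k b) := by
        intro u
        induction u with
        | zero => simp
        | add x y hx hy => simp only [map_add, hx, hy, TensorProduct.add_tmul, add_mul]
        | tmul y c =>
          simp only [TensorProduct.assoc_tmul, LinearMap.lTensor_tmul, hP, twistMap_tmul,
            LinearMap.rTensor_tmul, LinearMap.mul'_apply, map_mul, mul_assoc]
      rw [LinearMap.rTensor_tmul, h, mul_antipode_rTensor_comul_apply]
      simp [Algebra.algebraMap_eq_smul_one, Algebra.TensorProduct.one_def]
  have e3 : P (LinearMap.lTensor A ((TensorProduct.mk k A A).flip 1) (comul (R := k) a)) =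
      1 ⊗ₜ antipode k a := by
    rw [← e1, ← Coalgebra.coassoc_apply, e2]
    simp [applyFst]
  have e4 : ∀ t : A ⊗[k] A, applySnd k φ
      (P (LinearMap.lTensor A ((TensorProduct.mk k A A).flip 1) t)) =
      applyFst k (φ ∘ₗ antipode k) t := by
    intro t
    induction t with
    | zero => simp
    | add x y hx hy => simp only [map_add, hx, hy]
    | tmul x b =>
      simp only [LinearMap.lTensor_tmul, LinearMap.flip_apply, TensorProduct.mk_apply, hP]
      have h2 : ∀ u : A ⊗[k] A, applySnd k φ (u * (b ⊗ₜ 1)) = applySnd k φ u * b := by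
        intro u
        induction u with
        | zero => simp
        | add x y hx hy => simp only [map_add, hx, hy, add_mul]
        | tmul y b => simp
      rw [h2]
      change applySnd k φ (comul (antipode k x)) * b = _
      rw [hφ]; simp
  change applyFst k (φ ∘ₗ antipode k) (comul a) = _
  rw [← e4, e3]
  simp

/-- The modular element of `A`. -/
lemma exists_modular (φ : A →ₗ[k] k) (hne : φ ≠ 0)
    (hφ : ∀ a : A, applySnd k φ (comul a) = φ a • (1 : A))
    (hfl : ∀ a : A, (∀ b : A, φ (a * b) = 0) → a = 0)
    (hS : Function.Bijective (antipode k (A := A))) :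
    ∃ d : A, (∀ a : A, applySnd k (φ ∘ₗ antipode k) (comul a) = (φ ∘ₗ antipode k) a • d) ∧
      antipode k d * d = 1 := by
  set θ := φ ∘ₗ antipode k with hθ
  have key : ∀ x y : A, θ (y * applySnd k θ (comul x)) = φ y * θ x :=
    strong_invariance (Bialgebra.comulAlgHom k A) comulAlg_coassoc comulAlg_counit φ φ θ hφ
      (theta_invariant φ hφ)
  have faith : ∀ z : A, (∀ y, θ (y * z) = 0) → z = 0 := by
    intro z hz
    apply hS.1
    rw [map_zero]
    apply hfl
    intro b
    obtain ⟨y, rfl⟩ := hS.2 b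
    rw [← antipode_mul_antidistrib]
    exact hz y
  obtain ⟨b, hb⟩ : ∃ b, φ b ≠ 0 := by
    by_contra! h
    exact hne (LinearMap.ext h)
  obtain ⟨c, hc⟩ : ∃ c, θ c = 1 := by
    obtain ⟨y, hy⟩ := hS.2 b
    refine ⟨(φ b)⁻¹ • y, ?_⟩
    simp [hθ, hy, hb]
  have hd : ∀ a, applySnd k θ (comul a) = θ a • applySnd k θ (comul c) := by
    intro a
    rw [← sub_eq_zero]
    apply faith
    intro y
    rw [mul_sub, map_sub, key, mul_smul_comm, map_smul, key, hc]
    simp [mul_comm]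
  set d := applySnd k θ (comul c) with hdd
  have hdne : d ≠ 0 := by
    intro h0
    have := key c b
    rw [← hdd, h0, hc] at this
    simp at this
    exact hb this.symm
  have hcomul : comul (R := k) d = d ⊗ₜ d :=
    coaction_E (Bialgebra.comulAlgHom k A) comulAlg_coassoc θ d hd c
  have hcounit : counit (R := k) d = 1 := by
    have := comulAlg_counit (k := k) d
    simp only [Bialgebra.comulAlgHom_apply, hcomul, applySnd_tmul] at this
    have h3 : (counit (R := k) d - 1) • d = 0 := by rw [sub_smul, this]; simp
    rcases smul_eq_zero.1 h3 with h | h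
    · exact sub_eq_zero.1 h
    · exact absurd h hdne
  refine ⟨d, hd, ?_⟩
  have := mul_antipode_rTensor_comul_apply (R := k) d
  rw [hcomul] at this
  simpa [hcounit] using this

lemma galoisV_tmul (α : X →ₐ[k] X ⊗[k] A) (x y : X) :
    galoisV k A X α (x ⊗ₜ y) = (x ⊗ₜ 1) * α y := by
  simp [galoisV]

lemma phiX_faithful (G : GaloisContext k A X) (φX : X →ₗ[k] k)
    (hφX : ∀ x : X, applySnd k G.φ (G.α x) = φX x • (1 : X)) (z : X)
    (hz : ∀ x, φX (x * z) = 0) : z = 0 := by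
  have h1 : ∀ t, applySnd k G.φ (galoisV k A X G.α t * G.α z) = 0 := by
    intro t
    induction t with
    | zero => simp
    | add x y hx hy => simp only [map_add, hx, hy, add_mul, add_zero]
    | tmul y x =>
      rw [galoisV_tmul, mul_assoc, ← map_mul]
      have h : ∀ u : X ⊗[k] A, applySnd k G.φ ((y ⊗ₜ 1) * u) = y * applySnd k G.φ u := by
        intro u
        induction u with
        | zero => simp
        | add x y hx hy => simp only [map_add, hx, hy, mul_add]
        | tmul y b => simp
      rw [h, hφX, hz]; simp
  have h2 : ∀ f : X →ₗ[k] k, applyFst k f (G.α z) = 0 := by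
    intro f
    apply G.φ_faithful_right
    intro a
    obtain ⟨t, ht⟩ := G.galois.2 (1 ⊗ₜ a)
    have h3 := h1 t
    rw [ht] at h3
    have h4 : ∀ u : X ⊗[k] A, applyFst k f ((1 ⊗ₜ a) * u) = a * applyFst k f u := by
      intro u
      induction u with
      | zero => simp
      | add x y hx hy => simp only [map_add, hx, hy, mul_add]
      | tmul y b => simp
    rw [← h4, apply_fst_snd, h3, map_zero]
  rw [← Module.forall_dual_apply_eq_zero_iff k]
  intro f
  rw [← G.counit_id z, ← apply_fst_snd, h2, map_zero]

end Helpers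

theorem galois_object_exists_modular_element
    {k : Type*} [Field k] {A X : Type*} [Ring A] [HopfAlgebra k A]
    [Ring X] [Algebra k X] [Nontrivial X]
    (G : GaloisContext k A X)
    (φX : X →ₗ[k] k)
    (hφX : ∀ x : X, applySnd k G.φ (G.α x) = φX x • (1 : X))
    (ψX : X →ₗ[k] k) (hψX_ne : ψX ≠ 0)
    (hψX : ∀ x : X, applyFst k ψX (G.α x) = ψX x • (1 : A)) :
    ∃! δX : X, IsUnit δX ∧ ∀ x : X, φX (x * δX) = ψX x := by
  have faith := phiX_faithful G φX hφX
  obtain ⟨d, hd, hdinv⟩ := exists_modular G.φ G.φ_ne G.φ_integral G.φ_faithful_left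
    G.antipode_bijective
  have key := strong_invariance G.α G.coassoc G.counit_id G.φ φX ψX hφX hψX
  obtain ⟨c, hc⟩ : ∃ c, ψX c = 1 := by
    obtain ⟨b, hb⟩ : ∃ b, ψX b ≠ 0 := by
      by_contra! h
      exact hψX_ne (LinearMap.ext h)
    exact ⟨(ψX b)⁻¹ • b, by simp [hb]⟩
  have hαe := coaction_E G.α G.coassoc _ d hd c
  replace key := key c
  set e := applySnd k (G.φ ∘ₗ HopfAlgebra.antipode k) (G.α c) with he
  have hψe : ∀ y, ψX (y * e) = φX y := by
    intro y; rw [key, hc, mul_one]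
  have hene : e ≠ 0 := by
    intro h0
    refine one_ne_zero (faith 1 fun x => ?_)
    rw [← hψe, h0]; simp
  -- right inverse
  obtain ⟨r, hr⟩ : ∃ r, e * r = 1 := by
    obtain ⟨t, ht⟩ := G.galois.2 (1 ⊗ₜ d)
    have h1 : ∀ t, galoisV k A X G.α (LinearMap.rTensor X (LinearMap.mulLeft k e) t) =
        (e ⊗ₜ 1) * galoisV k A X G.α t := by
      intro t
      induction t with
      | zero => simp
      | add x y hx hy => simp only [map_add, hx, hy, mul_add]
      | tmul y x => simp [galoisV_tmul, ← mul_assoc]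
    have h2 : LinearMap.rTensor X (LinearMap.mulLeft k e) t = 1 ⊗ₜ e := by
      apply G.galois.1
      rw [h1, ht, galoisV_tmul, hαe]
      simp
    obtain ⟨f, hf⟩ : ∃ f : Module.Dual k X, f e ≠ 0 := by
      by_contra! h
      exact hene ((Module.forall_dual_apply_eq_zero_iff k e).1 h)
    have h3 : ∀ t, applySnd k f (LinearMap.rTensor X (LinearMap.mulLeft k e) t) =
        e * applySnd k f t := by
      intro t
      induction t with
      | zero => simp
      | add x y hx hy => simp only [map_add, hx, hy, mul_add]
      | tmul y x => simp
    refine ⟨(f e)⁻¹ • applySnd k f t, ?_⟩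
    rw [mul_smul_comm, ← h3, h2]
    simp [hf]
  have hinj : ∀ z, e * z = 0 → z = 0 := by
    intro z hz
    have h1 : galoisV k A X G.α (e ⊗ₜ z) = 0 := by
      have h2 : (e ⊗ₜ[k] (1 : A)) = (1 ⊗ₜ HopfAlgebra.antipode k d) * G.α e := by
        rw [hαe]; simp [hdinv]
      rw [galoisV_tmul, h2, mul_assoc, ← map_mul, hz]; simp
    have h3 : e ⊗ₜ[k] z = 0 := G.galois.1 (by rw [h1, map_zero])
    obtain ⟨f, hf⟩ : ∃ f : Module.Dual k X, f e ≠ 0 := by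
      by_contra! h
      exact hene ((Module.forall_dual_apply_eq_zero_iff k e).1 h)
    have h4 : f e • z = 0 := by rw [← applyFst_tmul, h3, map_zero]
    exact (smul_eq_zero.1 h4).resolve_left hf
  have hl : r * e = 1 := by
    rw [← sub_eq_zero]
    apply hinj
    rw [mul_sub, ← mul_assoc, hr]; simp
  refine ⟨r, ⟨⟨⟨r, e, hl, hr⟩, rfl⟩, fun x => ?_⟩, ?_⟩
  · rw [← hψe, mul_assoc, hl, mul_one]
  · rintro s ⟨_, hs⟩
    rw [← sub_eq_zero]
    apply faith
    intro x
    rw [mul_sub, map_sub, hs, ← hψe, mul_assoc, hl, mul_one, sub_self]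
end

section
/- Let X be a right A-Galois object and let σ be the modular automorphism of φ. Then for all y, p, q ∈ X and a ∈ A, writing b = S⁻¹(σ(a)) and β(c) = c^[1] ⊗ c^[2], one has φ_X(a^[2]·y)·φ_X(p·a^[1]·q) = φ_X(y·b^[1])·φ_X(p·b^[2]·q). -/
open TensorProduct

open TensorProduct

namespace GaloisAux

variable {k : Type*} [Field k] {A X : Type*} [Ring A] [HopfAlgebra k A] [Ring X] [Algebra k X]

theorem applySnd_tmul {M N : Type*} [AddCommGroup M] [Module k M]
    [AddCommGroup N] [Module k N] (f : N →ₗ[k] k) (m : M) (n : N) :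
    applySnd k f (m ⊗ₜ[k] n) = f n • m := by
  simp [applySnd]

theorem applyFst_tmul {M N : Type*} [AddCommGroup M] [Module k M]
    [AddCommGroup N] [Module k N] (f : M →ₗ[k] k) (m : M) (n : N) :
    applyFst k f (m ⊗ₜ[k] n) = f m • n := by
  simp [applyFst]

theorem galoisV_tmul (α : X →ₐ[k] X ⊗[k] A) (x y : X) :
    galoisV k A X α (x ⊗ₜ[k] y) = (x ⊗ₜ[k] (1 : A)) * α y := by
  simp [galoisV]

/-- The map `x ⊗ y ↦ α x * (y ⊗ 1)`. -/
noncomputable def W (α : X →ₐ[k] X ⊗[k] A) : X ⊗[k] X →ₗ[k] X ⊗[k] A :=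
  LinearMap.mul' k (X ⊗[k] A) ∘ₗ
    TensorProduct.map α.toLinearMap ((TensorProduct.mk k X A).flip 1)

theorem W_tmul (α : X →ₐ[k] X ⊗[k] A) (x y : X) :
    W α (x ⊗ₜ[k] y) = α x * (y ⊗ₜ[k] (1 : A)) := by
  simp [W]

/-- The map `x ⊗ a ↦ α x * (1 ⊗ S a)`. -/
noncomputable def Th (α : X →ₐ[k] X ⊗[k] A) : X ⊗[k] A →ₗ[k] X ⊗[k] A :=
  LinearMap.mul' k (X ⊗[k] A) ∘ₗ
    TensorProduct.map α.toLinearMap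
      (TensorProduct.mk k X A 1 ∘ₗ HopfAlgebra.antipode (R := k) (A := A))

theorem Th_tmul (α : X →ₐ[k] X ⊗[k] A) (x : X) (a : A) :
    Th α (x ⊗ₜ[k] a) = α x * (1 ⊗ₜ[k] HopfAlgebra.antipode (R := k) (A := A) a) := by
  simp [Th]

theorem Th_mul (α : X →ₐ[k] X ⊗[k] A) (x : X) (t : X ⊗[k] A) :
    Th α ((x ⊗ₜ[k] (1 : A)) * t) = α x * Th α t := by
  induction t with
  | zero => simp
  | add a b ha hb => rw [mul_add, map_add, map_add, ha, hb, mul_add]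
  | tmul z a =>
    rw [Algebra.TensorProduct.tmul_mul_tmul, one_mul, Th_tmul, Th_tmul, map_mul, mul_assoc]

theorem Th_eq (α : X →ₐ[k] X ⊗[k] A) (t : X ⊗[k] A) :
    Th α t = LinearMap.lTensor X (LinearMap.mul' k A ∘ₗ
      LinearMap.lTensor A (HopfAlgebra.antipode (R := k) (A := A)))
      (TensorProduct.assoc k X A A (LinearMap.rTensor A α.toLinearMap t)) := by
  induction t with
  | zero => simp
  | add a b ha hb => simp only [map_add, ha, hb]
  | tmul z a =>
    rw [Th_tmul, LinearMap.rTensor_tmul, AlgHom.toLinearMap_apply]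
    induction α z with
    | zero => simp
    | add u v hu hv => simp only [add_mul, TensorProduct.add_tmul, map_add, hu, hv]
    | tmul u v => simp

theorem Th_coact (G : GaloisContext k A X) (y : X) :
    Th G.α (G.α y) = y ⊗ₜ[k] (1 : A) := by
  rw [Th_eq, G.coassoc, ← LinearMap.comp_apply, ← LinearMap.lTensor_comp, LinearMap.comp_assoc,
    HopfAlgebra.mul_antipode_lTensor_comul]
  have key : ∀ t : X ⊗[k] A, LinearMap.lTensor X
      (Algebra.linearMap k A ∘ₗ Coalgebra.counit (R := k) (A := A)) t
      = (applySnd k (Coalgebra.counit (R := k) (A := A)) t) ⊗ₜ[k] (1 : A) := by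
    intro t
    induction t with
    | zero => simp
    | add a b ha hb => simp only [map_add, ha, hb, TensorProduct.add_tmul]
    | tmul z a =>
      simp [applySnd_tmul, Algebra.algebraMap_eq_smul_one, TensorProduct.smul_tmul]
  rw [key, G.counit_id]

theorem W_eq (G : GaloisContext k A X) (t : X ⊗[k] X) :
    W G.α t = Th G.α (galoisV k A X G.α t) := by
  induction t with
  | zero => simp
  | add a b ha hb => simp only [map_add, ha, hb]
  | tmul x y => rw [W_tmul, galoisV_tmul, Th_mul, Th_coact]

theorem V_beta (G : GaloisContext k A X) (a : A) :
    galoisV k A X G.α (G.β a) = 1 ⊗ₜ[k] a :=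
  G.V.apply_symm_apply (1 ⊗ₜ[k] a)

theorem W_beta (G : GaloisContext k A X) (a : A) :
    W G.α (G.β a) = 1 ⊗ₜ[k] HopfAlgebra.antipode (R := k) (A := A) a := by
  rw [W_eq, V_beta, Th_tmul, map_one, one_mul]

theorem applySnd_mul_left (f : A →ₗ[k] k) (x : X) (t : X ⊗[k] A) :
    applySnd k f ((x ⊗ₜ[k] (1 : A)) * t) = x * applySnd k f t := by
  induction t with
  | zero => simp
  | add a b ha hb => simp only [map_add, ha, hb, mul_add]
  | tmul z a => simp [applySnd_tmul]

theorem applySnd_mul_right (f : A →ₗ[k] k) (x : X) (t : X ⊗[k] A) :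
    applySnd k f (t * (x ⊗ₜ[k] (1 : A))) = applySnd k f t * x := by
  induction t with
  | zero => simp
  | add a b ha hb => simp only [map_add, ha, hb, add_mul]
  | tmul z a => simp [applySnd_tmul]

theorem left_eq (G : GaloisContext k A X) (φX : X →ₗ[k] k)
    (hφX : ∀ x : X, applySnd k G.φ (G.α x) = φX x • (1 : X)) (y : X) (t : X ⊗[k] X) :
    applySnd k (φX ∘ₗ LinearMap.mulRight k y) t
      = applySnd k G.φ (galoisV k A X G.α t * G.α y) := by
  induction t with
  | zero => simp
  | add a b ha hb => simp only [map_add, ha, hb, add_mul]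
  | tmul u v =>
    rw [galoisV_tmul, mul_assoc, ← map_mul, applySnd_mul_left, hφX, applySnd_tmul]
    simp

theorem right_eq (G : GaloisContext k A X) (φX : X →ₗ[k] k)
    (hφX : ∀ x : X, applySnd k G.φ (G.α x) = φX x • (1 : X)) (y : X) (t : X ⊗[k] X) :
    applyFst k (φX ∘ₗ LinearMap.mulLeft k y) t
      = applySnd k G.φ (G.α y * W G.α t) := by
  induction t with
  | zero => simp
  | add a b ha hb => simp only [map_add, ha, hb, mul_add]
  | tmul u v =>
    rw [W_tmul, ← mul_assoc, ← map_mul, applySnd_mul_right, hφX, applyFst_tmul]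
    simp

end GaloisAux

theorem galois_object_phiX_modularity_lemma
    {k : Type*} [Field k] {A X : Type*} [Ring A] [HopfAlgebra k A]
    [Ring X] [Algebra k X] [Nontrivial X]
    (G : GaloisContext k A X)
    (φX : X →ₗ[k] k)
    (hφX : ∀ x : X, applySnd k G.φ (G.α x) = φX x • (1 : X))
    (σ : A ≃ₐ[k] A) (hσ : ∀ a b : A, G.φ (a * b) = G.φ (b * σ a))
    (y p q : X) (a : A) :
    (φX ∘ₗ LinearMap.mulLeft k p ∘ₗ LinearMap.mulRight k q)
        (applySnd k (φX ∘ₗ LinearMap.mulRight k y) (G.β a))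
      = (φX ∘ₗ LinearMap.mulLeft k p ∘ₗ LinearMap.mulRight k q)
        (applyFst k (φX ∘ₗ LinearMap.mulLeft k y)
          (G.β (Function.invFun (⇑(HopfAlgebra.antipode (R := k) (A := A))) (σ a)))) := by
  congr 1
  rw [GaloisAux.left_eq G φX hφX, GaloisAux.right_eq G φX hφX, GaloisAux.V_beta,
    GaloisAux.W_beta, Function.invFun_eq (G.antipode_bijective.2 (σ a))]
  induction G.α y with
  | zero => simp
  | add u v hu hv => simp only [mul_add, add_mul, map_add, hu, hv]
  | tmul u v => simp [GaloisAux.applySnd_tmul, hσ a v]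
end

section
/- Let X be a right A-Galois object. Then the linear maps X ⊗ A → X ⊗ X given by x ⊗ a ↦ β(a)·(x ⊗ 1) and x ⊗ a ↦ (1 ⊗ x)·β(a) are bijections. -/
open TensorProduct

namespace GaloisAux

section Ent
variable {k : Type*} [Field k] {A X : Type*} [AddCommGroup A] [Module k A] [Coalgebra k A]
  [AddCommGroup X] [Module k X]

/-- `x ⊗ a ↦ f(a₁) x ⊗ a₂`. -/
noncomputable def M (f : A →ₗ[k] Module.End k X) : X ⊗[k] A →ₗ[k] X ⊗[k] A :=
  TensorProduct.lift
    ((LinearMap.lcomp k (X ⊗[k] A) (Coalgebra.comul (R := k) (A := A))) ∘ₗ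
      (LinearMap.rTensorHom A) ∘ₗ f.flip)

lemma M_tmul (f : A →ₗ[k] Module.End k X) (x : X) (a : A) :
    M f (x ⊗ₜ a) = LinearMap.rTensor A (f.flip x) (Coalgebra.comul (R := k) a) := rfl

/-- `p ⊗ q ↦ f q * g p`. -/
noncomputable def B (f g : A →ₗ[k] Module.End k X) : A ⊗[k] A →ₗ[k] Module.End k X :=
  TensorProduct.lift ((LinearMap.mul k (Module.End k X)).flip.compl₁₂ g f)

lemma B_tmul (f g : A →ₗ[k] Module.End k X) (p q : A) : B f g (p ⊗ₜ q) = f q * g p := rfl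

lemma M_comp (f g : A →ₗ[k] Module.End k X)
    (h : ∀ a : A, B f g (Coalgebra.comul (R := k) a) = Coalgebra.counit (R := k) a • 1)
    (u : X ⊗[k] A) : M f (M g u) = u := by
  induction u with
  | zero => simp
  | add u v hu hv => simp [hu, hv]
  | tmul x a =>
    have key : ∀ t : A ⊗[k] A, M f (LinearMap.rTensor A (g.flip x) t) =
        LinearMap.rTensor A ((B f g).flip x) ((TensorProduct.assoc k A A A).symm
          (LinearMap.lTensor A (Coalgebra.comul (R := k) (A := A)) t)) := by
      intro t
      induction t with
      | zero => simp
      | add u v hu hv => simp only [map_add, hu, hv]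
      | tmul p q =>
        rw [LinearMap.rTensor_tmul, M_tmul, LinearMap.lTensor_tmul]
        generalize Coalgebra.comul (R := k) q = s
        induction s with
        | zero => simp
        | add u v hu hv => simp only [map_add, hu, hv, tmul_add]
        | tmul c d => simp [B_tmul]
    rw [M_tmul, key, Coalgebra.coassoc_symm_apply, ← LinearMap.comp_apply,
      ← LinearMap.rTensor_comp]
    have : (B f g).flip x ∘ₗ Coalgebra.comul (R := k) (A := A) =
        (LinearMap.toSpanSingleton k X x) ∘ₗ Coalgebra.counit (R := k) (A := A) := by
      ext a
      simp [h]
    rw [this, LinearMap.rTensor_comp, LinearMap.comp_apply, Coalgebra.rTensor_counit_comul]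
    simp

lemma M_bij (f g : A →ₗ[k] Module.End k X)
    (h : ∀ a : A, B f g (Coalgebra.comul (R := k) a) = Coalgebra.counit (R := k) a • 1)
    (h' : ∀ a : A, B g f (Coalgebra.comul (R := k) a) = Coalgebra.counit (R := k) a • 1) :
    Function.Bijective (M f) :=
  Function.bijective_iff_has_inverse.2 ⟨M g, M_comp g f h', M_comp f g h⟩

variable (α : X →ₗ[k] X ⊗[k] A)

/-- `y ⊗ x ↦ m y x₀ ⊗ x₁`. -/
noncomputable def Vm (m : X →ₗ[k] Module.End k X) : X ⊗[k] X →ₗ[k] X ⊗[k] A :=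
  TensorProduct.lift ((LinearMap.lcomp k (X ⊗[k] A) α) ∘ₗ (LinearMap.rTensorHom A) ∘ₗ m)

lemma Vm_tmul (m : X →ₗ[k] Module.End k X) (y x : X) :
    Vm α m (y ⊗ₜ x) = LinearMap.rTensor A (m y) (α x) := rfl

lemma Vm_colinear (hα : ∀ x : X, TensorProduct.assoc k X A A ((LinearMap.rTensor A α) (α x))
      = LinearMap.lTensor X (Coalgebra.comul (R := k) (A := A)) (α x))
    (m : X →ₗ[k] Module.End k X) (z : X ⊗[k] X) :
    LinearMap.rTensor A (Vm α m) ((TensorProduct.assoc k X X A).symm (LinearMap.lTensor X α z)) =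
      (TensorProduct.assoc k X A A).symm
        (LinearMap.lTensor X (Coalgebra.comul (R := k) (A := A)) (Vm α m z)) := by
  induction z with
  | zero => simp
  | add u v hu hv => simp only [map_add, hu, hv]
  | tmul y x =>
    rw [LinearMap.lTensor_tmul, Vm_tmul]
    have h1 : ∀ u : X ⊗[k] A, LinearMap.rTensor A (Vm α m)
        ((TensorProduct.assoc k X X A).symm (y ⊗ₜ u)) =
        LinearMap.rTensor A (LinearMap.rTensor A (m y)) (LinearMap.rTensor A α u) := by
      intro u
      induction u with
      | zero => simp
      | add u v hu hv => simp only [map_add, tmul_add, hu, hv]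
      | tmul p c => simp [Vm_tmul]
    have h2 : ∀ u : X ⊗[k] A, (TensorProduct.assoc k X A A).symm
        (LinearMap.lTensor X (Coalgebra.comul (R := k) (A := A)) (LinearMap.rTensor A (m y) u)) =
        LinearMap.rTensor A (LinearMap.rTensor A (m y)) ((TensorProduct.assoc k X A A).symm
        (LinearMap.lTensor X (Coalgebra.comul (R := k) (A := A)) u)) := by
      intro u
      induction u with
      | zero => simp
      | add u v hu hv => simp only [map_add, hu, hv]
      | tmul p c =>
        simp only [LinearMap.rTensor_tmul, LinearMap.lTensor_tmul]
        generalize Coalgebra.comul (R := k) c = s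
        induction s with
        | zero => simp
        | add u v hu hv => simp only [map_add, tmul_add, hu, hv]
        | tmul c d => simp
    rw [h1, h2, ← hα, LinearEquiv.symm_apply_apply]

lemma γ_colinear (hα : ∀ x : X, TensorProduct.assoc k X A A ((LinearMap.rTensor A α) (α x))
      = LinearMap.lTensor X (Coalgebra.comul (R := k) (A := A)) (α x))
    (m : X →ₗ[k] Module.End k X) (hV : Function.Bijective (Vm α m)) (e : X)
    (γ : A →ₗ[k] X ⊗[k] X) (hγ : ∀ a, Vm α m (γ a) = e ⊗ₜ a) (a : A) :
    (TensorProduct.assoc k X X A).symm (LinearMap.lTensor X α (γ a)) =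
      LinearMap.rTensor A γ (Coalgebra.comul (R := k) a) := by
  have inj : Function.Injective (LinearMap.rTensor A (Vm α m)) :=
    Module.Flat.rTensor_preserves_injective_linearMap _ hV.1
  apply inj
  rw [Vm_colinear α hα, hγ, ← LinearMap.comp_apply (LinearMap.rTensor A (Vm α m)),
    ← LinearMap.rTensor_comp, LinearMap.lTensor_tmul]
  have : Vm α m ∘ₗ γ = TensorProduct.mk k X A e := by ext a; exact hγ a
  rw [this]
  generalize Coalgebra.comul (R := k) a = s
  induction s with
  | zero => simp
  | add u v hu hv => simp only [map_add, tmul_add, hu, hv]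
  | tmul c d => simp

/-- key statement: `n(γ(a)¹ ⊗ γ(a)²₀) ⊗ γ(a)²₁ = n(γ(a₁)) ⊗ a₂`. -/
lemma γ_colinear' (hα : ∀ x : X, TensorProduct.assoc k X A A ((LinearMap.rTensor A α) (α x))
      = LinearMap.lTensor X (Coalgebra.comul (R := k) (A := A)) (α x))
    (m : X →ₗ[k] Module.End k X) (hV : Function.Bijective (Vm α m)) (e : X)
    (γ : A →ₗ[k] X ⊗[k] X) (hγ : ∀ a, Vm α m (γ a) = e ⊗ₜ a) (a : A)
    (n : X →ₗ[k] Module.End k X) :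
    Vm α n (γ a) = LinearMap.rTensor A (TensorProduct.lift n ∘ₗ γ)
      (Coalgebra.comul (R := k) a) := by
  rw [LinearMap.rTensor_comp, LinearMap.comp_apply, ← γ_colinear α hα m hV e γ hγ]
  generalize γ a = z
  induction z with
  | zero => simp
  | add u v hu hv => simp only [map_add, hu, hv]
  | tmul y x =>
    rw [Vm_tmul, LinearMap.lTensor_tmul]
    generalize α x = u
    induction u with
    | zero => simp
    | add u v hu hv => simp only [map_add, tmul_add, hu, hv]
    | tmul p c => simp

end Ent

section Phi
variable {k : Type*} [Field k] {A X : Type*} [Ring A] [HopfAlgebra k A]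
  [AddCommGroup X] [Module k X] (α : X →ₗ[k] X ⊗[k] A)

/-- `x ⊗ a ↦ x₀ ⊗ f(x₁) a`. -/
noncomputable def Phi (f : A →ₗ[k] A) : X ⊗[k] A →ₗ[k] X ⊗[k] A :=
  TensorProduct.lift (LinearMap.flip ((LinearMap.lcomp k (X ⊗[k] A) α) ∘ₗ
      (LinearMap.lTensorHom X) ∘ₗ ((LinearMap.mul k A).comp f).flip))

lemma Phi_tmul (f : A →ₗ[k] A) (x : X) (a : A) :
    Phi α f (x ⊗ₜ a) = LinearMap.lTensor X (((LinearMap.mul k A).comp f).flip a) (α x) := rfl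

lemma Phi_comp (hα : ∀ x : X, TensorProduct.assoc k X A A ((LinearMap.rTensor A α) (α x))
      = LinearMap.lTensor X (Coalgebra.comul (R := k) (A := A)) (α x))
    (hε : ∀ x : X, LinearMap.lTensor X (Coalgebra.counit (R := k) (A := A)) (α x) = x ⊗ₜ 1)
    (f g : A →ₗ[k] A)
    (h : ∀ a : A, LinearMap.mul' k A (TensorProduct.map f g (Coalgebra.comul (R := k) a)) =
      algebraMap k A (Coalgebra.counit (R := k) a)) (u : X ⊗[k] A) :
    Phi α f (Phi α g u) = u := by
  induction u with
  | zero => simp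
  | add u v hu hv => simp [hu, hv]
  | tmul x a =>
    have key : ∀ t : X ⊗[k] A, Phi α f (LinearMap.lTensor X (((LinearMap.mul k A).comp g).flip a) t)
        = LinearMap.lTensor X (LinearMap.mulRight k a ∘ₗ LinearMap.mul' k A ∘ₗ TensorProduct.map f g)
          (TensorProduct.assoc k X A A (LinearMap.rTensor A α t)) := by
      intro t
      induction t with
      | zero => simp
      | add u v hu hv => simp only [map_add, hu, hv]
      | tmul p c =>
        rw [LinearMap.lTensor_tmul, Phi_tmul, LinearMap.rTensor_tmul]
        generalize α p = s
        induction s with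
        | zero => simp
        | add u v hu hv => simp only [map_add, hu, hv, add_tmul]
        | tmul q d => simp [mul_assoc]
    rw [Phi_tmul, key, hα, ← LinearMap.comp_apply, ← LinearMap.lTensor_comp]
    have : (LinearMap.mulRight k a ∘ₗ LinearMap.mul' k A ∘ₗ TensorProduct.map f g) ∘ₗ
        Coalgebra.comul (R := k) (A := A) =
        (LinearMap.toSpanSingleton k A a) ∘ₗ Coalgebra.counit (R := k) (A := A) := by
      ext b
      simp [h, Algebra.smul_def]
    rw [this, LinearMap.lTensor_comp, LinearMap.comp_apply, hε]
    simp

end Phi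

section Main
variable {k : Type*} [Field k] {A X : Type*} [Ring A] [HopfAlgebra k A]
  [Ring X] [Algebra k X] (G : GaloisContext k A X)

lemma eps (x : X) :
    LinearMap.lTensor X (Coalgebra.counit (R := k) (A := A)) (G.α x) = x ⊗ₜ 1 := by
  have := G.counit_id x
  unfold applySnd at this
  rw [LinearMap.comp_apply, LinearEquiv.coe_coe] at this
  rw [← (TensorProduct.rid k X).symm_apply_apply (LinearMap.lTensor X _ (G.α x)), this]
  simp

lemma Vm_eq : Vm G.α.toLinearMap (LinearMap.mul k X) = galoisV k A X G.α := by
  apply TensorProduct.ext'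
  intro x y
  rw [Vm_tmul]
  simp only [galoisV, LinearMap.comp_apply, map_tmul, LinearMap.mul'_apply]
  generalize G.α.toLinearMap y = u
  induction u with
  | zero => simp
  | add u v hu hv => simp only [map_add, mul_add, hu, hv]
  | tmul p c => simp

lemma V_β (a : A) : Vm G.α.toLinearMap (LinearMap.mul k X) (G.β a) = 1 ⊗ₜ a := by
  rw [Vm_eq]
  exact G.V.apply_symm_apply _

/-- `x ↦ (p ⊗ q ↦ p x q)`. -/
noncomputable def sand (k : Type*) [Field k] {X : Type*} [Ring X] [Algebra k X] :
    X ⊗[k] X →ₗ[k] Module.End k X :=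
  TensorProduct.lift ((LinearMap.mul k (Module.End k X)).compl₁₂
    (LinearMap.mul k X) (LinearMap.mul k X).flip)

lemma sand_tmul (p q x : X) : sand k (p ⊗ₜ q) x = p * (x * q) := rfl

noncomputable def rho : A →ₗ[k] Module.End k X := sand k ∘ₗ G.β

lemma Vm_mul (z w : X ⊗[k] X) (a b : A)
    (hz : Vm G.α.toLinearMap (LinearMap.mul k X) z = 1 ⊗ₜ a)
    (hw : Vm G.α.toLinearMap (LinearMap.mul k X) w = 1 ⊗ₜ b) :
    ∃ t, Vm G.α.toLinearMap (LinearMap.mul k X) t = 1 ⊗ₜ (a * b) ∧ sand k t = sand k w * sand k z := by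
  have key : ∀ w : X ⊗[k] X, ∃ t, Vm G.α.toLinearMap (LinearMap.mul k X) t =
      (1 ⊗ₜ a) * Vm G.α.toLinearMap (LinearMap.mul k X) w ∧ sand k t = sand k w * sand k z := by
    intro w
    induction w with
    | zero => exact ⟨0, by simp⟩
    | add u v hu hv =>
      obtain ⟨t, h1, h2⟩ := hu
      obtain ⟨t', h1', h2'⟩ := hv
      exact ⟨t + t', by simp only [map_add, h1, h1', mul_add], by
        simp only [map_add, h2, h2', add_mul]⟩
    | tmul r s =>
      refine ⟨TensorProduct.map (LinearMap.mulLeft k r) (LinearMap.mulRight k s) z, ?_, ?_⟩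
      · have : ∀ z : X ⊗[k] X, Vm G.α.toLinearMap (LinearMap.mul k X)
            (TensorProduct.map (LinearMap.mulLeft k r) (LinearMap.mulRight k s) z) =
            (r ⊗ₜ 1) * Vm G.α.toLinearMap (LinearMap.mul k X) z * G.α s := by
          intro z
          rw [Vm_eq]
          induction z with
          | zero => simp
          | add u v hu hv => simp only [map_add, hu, hv, add_mul, mul_add]
          | tmul p q =>
            simp only [galoisV, LinearMap.comp_apply, map_tmul, LinearMap.mul'_apply]
            simp [← mul_assoc]
        rw [this, hz, Vm_eq]
        simp only [galoisV, LinearMap.comp_apply, map_tmul, LinearMap.mul'_apply]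
        simp [← mul_assoc]
      · clear hz
        induction z with
        | zero => simp
        | add u v hu hv => simp only [map_add, hu, hv, mul_add]
        | tmul p q => ext x; simp [sand_tmul, mul_assoc]
  obtain ⟨t, h1, h2⟩ := key w
  exact ⟨t, by rw [h1, hw]; simp, h2⟩

lemma Vm_inj : Function.Injective (Vm G.α.toLinearMap (LinearMap.mul k X)) := by
  rw [Vm_eq]; exact G.galois.1

lemma rho_mul (a b : A) : rho G (a * b) = rho G b * rho G a := by
  obtain ⟨t, h1, h2⟩ := Vm_mul G (G.β a) (G.β b) a b (V_β G a) (V_β G b)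
  rw [← V_β G (a * b)] at h1
  have := Vm_inj G h1
  subst this
  exact h2

lemma rho_one : rho G 1 = 1 := by
  have : G.β 1 = 1 ⊗ₜ 1 := by
    apply Vm_inj G
    rw [V_β, Vm_tmul]
    simp [Algebra.TensorProduct.one_def]
  ext x
  simp [rho, this, sand_tmul]

lemma rho_algebraMap (c : k) : rho G (algebraMap k A c) = c • 1 := by
  rw [Algebra.algebraMap_eq_smul_one, map_smul, rho_one]

lemma first : Function.Bijective
      (LinearMap.mul' k (X ⊗[k] X) ∘ₗ
        TensorProduct.map G.β ((TensorProduct.mk k X X).flip 1) ∘ₗ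
          (TensorProduct.comm k X A).toLinearMap) := by
  set T := (LinearMap.mul' k (X ⊗[k] X) ∘ₗ
        TensorProduct.map G.β ((TensorProduct.mk k X X).flip 1) ∘ₗ
          (TensorProduct.comm k X A).toLinearMap) with hT
  have hM : Function.Bijective (M (rho G)) := by
    apply M_bij (rho G) (rho G ∘ₗ HopfAlgebra.antipode k)
    · intro a
      rw [← rho_algebraMap G, ← HopfAlgebra.mul_antipode_rTensor_comul_apply]
      generalize Coalgebra.comul (R := k) a = s
      induction s with
      | zero => simp
      | add u v hu hv => simp only [map_add, hu, hv]
      | tmul c d => simp [B_tmul, rho_mul]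
    · intro a
      rw [← rho_algebraMap G, ← HopfAlgebra.mul_antipode_lTensor_comul_apply]
      generalize Coalgebra.comul (R := k) a = s
      induction s with
      | zero => simp
      | add u v hu hv => simp only [map_add, hu, hv]
      | tmul c d => simp [B_tmul, rho_mul]
  have hV : Function.Bijective (Vm G.α.toLinearMap (LinearMap.mul k X)) := by
    rw [Vm_eq]; exact G.galois
  have : Vm G.α.toLinearMap (LinearMap.mul k X) ∘ₗ T = M (rho G) := by
    apply TensorProduct.ext'
    intro x a
    have h := γ_colinear' G.α.toLinearMap G.coassoc (LinearMap.mul k X) hV 1 G.β (V_β G) a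
      (LinearMap.mul k X ∘ₗ LinearMap.mulRight k x)
    have e1 : TensorProduct.lift (LinearMap.mul k X ∘ₗ LinearMap.mulRight k x) ∘ₗ G.β
        = (rho G).flip x := by
      ext a
      simp only [rho, LinearMap.comp_apply, LinearMap.flip_apply]
      generalize G.β a = s
      induction s with
      | zero => simp
      | add u v hu hv => simp only [map_add, hu, hv, LinearMap.add_apply]
      | tmul c d => simp [sand_tmul, mul_assoc]
    rw [M_tmul, ← e1, ← h, hT]
    simp only [LinearMap.comp_apply, LinearEquiv.coe_coe, comm_tmul, map_tmul,
      LinearMap.mul'_apply]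
    generalize G.β a = s
    induction s with
    | zero => simp
    | add u v hu hv => simp only [map_add, hu, hv, add_mul]
    | tmul c d => simp [Vm_tmul]
  refine (Function.Bijective.of_comp_iff' hV T).1 ?_
  rw [← LinearMap.coe_comp, this]
  exact hM

lemma second : Function.Bijective
      (LinearMap.mul' k (X ⊗[k] X) ∘ₗ
        TensorProduct.map (TensorProduct.mk k X X 1) G.β) := by
  set T := (LinearMap.mul' k (X ⊗[k] X) ∘ₗ
        TensorProduct.map (TensorProduct.mk k X X 1) G.β) with hT
  let S : A ≃ₗ[k] A := LinearEquiv.ofBijective (HopfAlgebra.antipode k) G.antipode_bijective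
  have hS : ∀ a, S a = HopfAlgebra.antipode k a := fun _ => rfl
  have hSmul : ∀ a b, S.symm (a * b) = S.symm b * S.symm a := by
    intro a b
    rw [LinearEquiv.symm_apply_eq, hS, HopfAlgebra.antipode_mul_antidistrib, ← hS, ← hS]
    simp
  have hSal : ∀ c, S.symm (algebraMap k A c) = algebraMap k A c := by
    intro c
    rw [LinearEquiv.symm_apply_eq, hS, Algebra.algebraMap_eq_smul_one, map_smul,
      HopfAlgebra.antipode_one]
  -- the bijection `M`
  have hM : Function.Bijective (M (rho G ∘ₗ S.symm.toLinearMap)) := by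
    apply M_bij _ (rho G ∘ₗ S.symm.toLinearMap ∘ₗ S.symm.toLinearMap)
    · intro a
      rw [← rho_algebraMap G, ← hSal, ← hSal, ← HopfAlgebra.mul_antipode_lTensor_comul_apply]
      generalize Coalgebra.comul (R := k) a = s
      induction s with
      | zero => simp
      | add u v hu hv => simp only [map_add, hu, hv]
      | tmul c d => simp [B_tmul, rho_mul, hSmul, ← hS]
    · intro a
      rw [← rho_algebraMap G, ← hSal, ← hSal, ← HopfAlgebra.mul_antipode_rTensor_comul_apply]
      generalize Coalgebra.comul (R := k) a = s
      induction s with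
      | zero => simp
      | add u v hu hv => simp only [map_add, hu, hv]
      | tmul c d => simp [B_tmul, rho_mul, hSmul, ← hS]
  -- the other Galois map
  set W := Vm G.α.toLinearMap (LinearMap.mul k X).flip with hW
  have hp1 := Phi_comp G.α.toLinearMap G.coassoc (eps G) LinearMap.id (HopfAlgebra.antipode k)
    (fun a => HopfAlgebra.mul_antipode_lTensor_comul_apply a)
  have hp2 := Phi_comp G.α.toLinearMap G.coassoc (eps G) (HopfAlgebra.antipode k) LinearMap.id
    (fun a => HopfAlgebra.mul_antipode_rTensor_comul_apply a)
  have hPhi : Function.Bijective (Phi G.α.toLinearMap (LinearMap.id : A →ₗ[k] A)) :=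
    Function.bijective_iff_has_inverse.2 ⟨_, hp2, hp1⟩
  have hPhit : ∀ (x : X) (a : A), Phi G.α.toLinearMap (LinearMap.id : A →ₗ[k] A) (x ⊗ₜ a) =
      G.α x * (1 ⊗ₜ a) := by
    intro x a
    rw [Phi_tmul, AlgHom.toLinearMap_apply]
    generalize G.α x = u
    induction u with
    | zero => simp
    | add u v hu hv => simp only [map_add, hu, hv, add_mul]
    | tmul c d => simp
  have hWP : ∀ z, W (TensorProduct.comm k X X z) = Phi G.α.toLinearMap (LinearMap.id : A →ₗ[k] A)
      (TensorProduct.congr (LinearEquiv.refl k X) S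
        (Vm G.α.toLinearMap (LinearMap.mul k X) z)) := by
    intro z
    induction z with
    | zero => simp
    | add u v hu hv => simp only [map_add, hu, hv]
    | tmul x y =>
      have hy : Phi G.α.toLinearMap (LinearMap.id : A →ₗ[k] A)
          (TensorProduct.congr (LinearEquiv.refl k X) S (G.α y)) = y ⊗ₜ 1 := by
        rw [← hp1 (y ⊗ₜ 1), Phi_tmul, AlgHom.toLinearMap_apply]
        congr 1
        generalize G.α y = u
        induction u with
        | zero => simp
        | add u v hu hv => simp only [map_add, hu, hv]
        | tmul c d => simp [hS]
      have h2 : ∀ u : X ⊗[k] A, Phi G.α.toLinearMap (LinearMap.id : A →ₗ[k] A)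
          (TensorProduct.congr (LinearEquiv.refl k X) S (LinearMap.rTensor A (LinearMap.mul k X x) u))
          = G.α x * Phi G.α.toLinearMap (LinearMap.id : A →ₗ[k] A)
          (TensorProduct.congr (LinearEquiv.refl k X) S u) := by
        intro u
        induction u with
        | zero => simp
        | add u v hu hv => simp only [map_add, hu, hv, mul_add]
        | tmul c d => simp [hPhit, mul_assoc]
      rw [comm_tmul, hW, Vm_tmul, Vm_tmul, AlgHom.toLinearMap_apply, AlgHom.toLinearMap_apply,
        h2, hy]
      generalize G.α x = u
      induction u with
      | zero => simp
      | add u v hu hv => simp only [map_add, hu, hv, add_mul]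
      | tmul c d => simp
  have hV : Function.Bijective (Vm G.α.toLinearMap (LinearMap.mul k X)) := by
    rw [Vm_eq]; exact G.galois
  have hWb : Function.Bijective W := by
    refine (Function.Bijective.of_comp_iff W (TensorProduct.comm k X X).bijective).1 ?_
    have : (W ∘ (TensorProduct.comm k X X)) = _ := funext hWP
    rw [this]
    exact hPhi.comp ((LinearEquiv.bijective _).comp hV)
  let γ : A →ₗ[k] X ⊗[k] X := (TensorProduct.comm k X X).toLinearMap ∘ₗ G.β ∘ₗ S.symm.toLinearMap
  have hγ : ∀ a, W (γ a) = 1 ⊗ₜ a := by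
    intro a
    change W (TensorProduct.comm k X X (G.β (S.symm a))) = _
    rw [hWP, V_β]
    simp [hPhit]
  have hfin : W ∘ₗ (TensorProduct.comm k X X).toLinearMap ∘ₗ T ∘ₗ
      (TensorProduct.congr (LinearEquiv.refl k X) S.symm).toLinearMap =
      M (rho G ∘ₗ S.symm.toLinearMap) := by
    apply TensorProduct.ext'
    intro x a
    have h := γ_colinear' G.α.toLinearMap G.coassoc (LinearMap.mul k X).flip hWb 1 γ hγ a
      ((LinearMap.mul k X).flip ∘ₗ LinearMap.mulLeft k x)
    have e1 : TensorProduct.lift ((LinearMap.mul k X).flip ∘ₗ LinearMap.mulLeft k x) ∘ₗ γ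
        = (rho G ∘ₗ S.symm.toLinearMap).flip x := by
      ext a
      simp only [γ, rho, LinearMap.comp_apply, LinearMap.flip_apply, LinearEquiv.coe_coe]
      generalize G.β (S.symm a) = s
      induction s with
      | zero => simp
      | add u v hu hv => simp only [map_add, hu, hv, LinearMap.add_apply]
      | tmul c d => simp [sand_tmul, mul_assoc]
    rw [M_tmul, ← e1, ← h, hT, hW]
    simp only [γ, LinearMap.comp_apply, LinearEquiv.coe_coe, congr_tmul, map_tmul,
      LinearMap.mul'_apply, LinearEquiv.refl_apply]
    generalize G.β (S.symm a) = s
    induction s with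
    | zero => simp
    | add u v hu hv => simp only [map_add, hu, hv, mul_add]
    | tmul c d => simp [Vm_tmul]
  rw [← hfin] at hM
  have h1 := (Function.Bijective.of_comp_iff' hWb _).1 hM
  have h2 := (Function.Bijective.of_comp_iff' (TensorProduct.comm k X X).bijective _).1 h1
  exact (Function.Bijective.of_comp_iff T
    (TensorProduct.congr (LinearEquiv.refl k X) S.symm).bijective).1 h2

end Main

end GaloisAux

theorem galois_object_beta_maps_bijective
    {k : Type*} [Field k] {A X : Type*} [Ring A] [HopfAlgebra k A]
    [Ring X] [Algebra k X] [Nontrivial X]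
    (G : GaloisContext k A X) :
    Function.Bijective
      (LinearMap.mul' k (X ⊗[k] X) ∘ₗ
        TensorProduct.map G.β ((TensorProduct.mk k X X).flip 1) ∘ₗ
          (TensorProduct.comm k X A).toLinearMap) ∧
    Function.Bijective
      (LinearMap.mul' k (X ⊗[k] X) ∘ₗ
        TensorProduct.map (TensorProduct.mk k X X 1) G.β) :=
  ⟨GaloisAux.first G, GaloisAux.second G⟩
end

section
/- Let X be a right A-Galois object. With θ_X : X → X defined by θ_X(x) = ε(σ⁻¹(x₍₁₎))·σ_X(x₍₀₎), the following hold: (i) α ∘ σ_X = (θ_X ⊗ σ) ∘ α; (ii) α ∘ θ_X = (θ_X ⊗ S²) ∘ α; (iii) α ∘ θ_X = (σ_X ⊗ σ'⁻¹) ∘ α, where σ' is the modular automorphism of the right integral ψ = φ∘S on A. -/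
open TensorProduct

/-- The analogue `θ_X` of the square of the antipode on a Galois object:
`θ_X(x) = ε(σ⁻¹(x₍₁₎)) • σ_X(x₍₀₎)`. -/
noncomputable def thetaX {k : Type*} [Field k] {A X : Type*} [Ring A] [HopfAlgebra k A]
    [Ring X] [Algebra k X] (G : GaloisContext k A X) (σ : A ≃ₐ[k] A) (σX : X ≃ₐ[k] X) :
    X →ₗ[k] X :=
  σX.toLinearMap ∘ₗ
    applySnd k ((Coalgebra.counit (R := k) (A := A)) ∘ₗ σ.symm.toLinearMap) ∘ₗ
      G.α.toLinearMap

namespace GalAux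

open Coalgebra HopfAlgebra WithConv

section basic
variable {k : Type*} [Field k] {M N P : Type*} [AddCommGroup M] [Module k M]
  [AddCommGroup N] [Module k N] [AddCommGroup P] [Module k P]

@[simp] lemma applySnd_tmul (f : N →ₗ[k] k) (m : M) (n : N) :
    applySnd k f (m ⊗ₜ[k] n) = f n • m := by
  simp [applySnd]

lemma applySnd_map (f : N →ₗ[k] k) (g : M →ₗ[k] P) (h : N →ₗ[k] N) (t : M ⊗[k] N) :
    applySnd k f (TensorProduct.map g h t) = g (applySnd k (f ∘ₗ h) t) := by
  induction t with
  | zero => simp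
  | add a b ha hb => simp only [map_add, ha, hb]
  | tmul a b => simp

end basic

section sep
variable {k : Type*} [Field k] {A M : Type*} [Ring A] [Algebra k A] [AddCommGroup M] [Module k M]

lemma separation (φ : A →ₗ[k] k) (hφ : ∀ a : A, (∀ b : A, φ (b * a) = 0) → a = 0)
    (w w' : M ⊗[k] A)
    (h : ∀ a : A, applySnd k (φ ∘ₗ LinearMap.mulLeft k a) w
      = applySnd k (φ ∘ₗ LinearMap.mulLeft k a) w') : w = w' := by
  have key : ∀ χ : M →ₗ[k] k, applyFst k χ w = applyFst k χ w' := by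
    intro χ
    rw [← sub_eq_zero]
    apply hφ
    intro b
    have comm : ∀ t : M ⊗[k] A, φ (b * applyFst k χ t)
        = χ (applySnd k (φ ∘ₗ LinearMap.mulLeft k b) t) := by
      intro t
      induction t with
      | zero => simp
      | add a b ha hb => simp only [map_add, mul_add, ha, hb]
      | tmul a b => simp [applyFst, mul_comm]
    rw [mul_sub, map_sub, comm, comm, h, sub_self]
  classical
  let B := Module.Basis.ofVectorSpace k M
  apply (TensorProduct.equivFinsuppOfBasisLeft (N := A) B).injective
  ext i
  rw [TensorProduct.equivFinsuppOfBasisLeft_apply, TensorProduct.equivFinsuppOfBasisLeft_apply]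
  exact key _

end sep

section hopf
variable {k : Type*} [Field k] {A : Type*} [Ring A] [HopfAlgebra k A]

/-- strong left invariance -/
lemma strong_inv (φ : A →ₗ[k] k)
    (hφ : ∀ a : A, applySnd k φ (comul a) = φ a • (1 : A)) (b a : A) :
    applySnd k (φ ∘ₗ LinearMap.mulLeft k b) (comul a)
      = antipode k (applySnd k (φ ∘ₗ LinearMap.mulRight k a) (comul b)) := by
  let Ψ : A ⊗[k] (A ⊗[k] A) →ₗ[k] A := LinearMap.mul' k A ∘ₗ
    TensorProduct.map (antipode k) (applySnd k φ ∘ₗ LinearMap.mulRight k (comul (R := k) a))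
  have h1 : ∀ t : A ⊗[k] A, Ψ (LinearMap.lTensor A comul t)
      = antipode k (applySnd k (φ ∘ₗ LinearMap.mulRight k a) t) := by
    intro t
    induction t with
    | zero => simp
    | add a b ha hb => simp only [map_add, ha, hb]
    | tmul p q =>
      simp only [Ψ, LinearMap.comp_apply, LinearMap.lTensor_tmul, TensorProduct.map_tmul,
        LinearMap.mulRight_apply, ← Bialgebra.comul_mul, hφ, applySnd_tmul, LinearMap.mul'_apply,
        map_smul, mul_smul_comm, mul_one]
  have hc : ∀ (p q : A) (r : A ⊗[k] A), applySnd k φ ((p ⊗ₜ[k] q) * r)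
      = p * applySnd k (φ ∘ₗ LinearMap.mulLeft k q) r := by
    intro p q r
    induction r with
    | zero => simp
    | add a b ha hb => simp only [map_add, mul_add, ha, hb]
    | tmul u v => simp
  have h2 : ∀ t : A ⊗[k] A, Ψ (TensorProduct.assoc k A A A (LinearMap.rTensor A comul t))
      = applySnd k (φ ∘ₗ LinearMap.mulLeft k (applyFst k counit t)) (comul a) := by
    intro t
    induction t with
    | zero => simp [applySnd]
    | add x y hx hy =>
      simp only [map_add, hx, hy]
      have h7 : ∀ c d : A, φ ∘ₗ LinearMap.mulLeft k (c + d)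
          = φ ∘ₗ LinearMap.mulLeft k c + φ ∘ₗ LinearMap.mulLeft k d := by
        intro c d; ext; simp [add_mul]
      rw [h7]
      simp [applySnd, LinearMap.lTensor_add]
    | tmul p q =>
      have h3 : ∀ s : A ⊗[k] A, Ψ (TensorProduct.assoc k A A A (s ⊗ₜ q))
          = LinearMap.mul' k A (LinearMap.rTensor A (antipode k) s)
            * applySnd k (φ ∘ₗ LinearMap.mulLeft k q) (comul a) := by
        intro s
        induction s with
        | zero => simp
        | add a b ha hb => simp only [map_add, TensorProduct.add_tmul, add_mul, ha, hb]
        | tmul u v => simp [Ψ, hc, mul_assoc]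
      rw [LinearMap.rTensor_tmul, h3, mul_antipode_rTensor_comul_apply, ← Algebra.smul_def]
      have h4 : applyFst k counit (p ⊗ₜ[k] q) = counit (R := k) p • q := by simp [applyFst]
      rw [h4]
      have h5 : φ ∘ₗ LinearMap.mulLeft k (counit (R := k) p • q)
          = counit (R := k) p • (φ ∘ₗ LinearMap.mulLeft k q) := by
        ext; simp
      rw [h5]
      simp [applySnd]
  have h6 := h1 (comul b)
  rw [← Coalgebra.coassoc_apply, h2] at h6
  rw [← h6]
  simp [applyFst]

lemma comul_modular (φ : A →ₗ[k] k)
    (hφ : ∀ a : A, applySnd k φ (comul a) = φ a • (1 : A))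
    (hf : ∀ a : A, (∀ b : A, φ (b * a) = 0) → a = 0)
    (σ : A ≃ₐ[k] A) (hσ : ∀ a b : A, φ (a * b) = φ (b * σ a)) (b : A) :
    comul (R := k) (σ b) = TensorProduct.map (antipode k ∘ₗ antipode k) σ.toLinearMap (comul b) := by
  apply separation φ hf
  intro a
  rw [strong_inv φ hφ, applySnd_map]
  have e1 : φ ∘ₗ LinearMap.mulRight k (σ b) = φ ∘ₗ LinearMap.mulLeft k b := by
    ext c; simp [hσ b c]
  have e2 : (φ ∘ₗ LinearMap.mulLeft k a) ∘ₗ σ.toLinearMap = φ ∘ₗ LinearMap.mulRight k a := by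
    ext c; simp [hσ c a]
  rw [e1, e2, strong_inv φ hφ]
  rfl

/-- a functional viewed as a convolution element -/
noncomputable def eta (f : A →ₗ[k] k) : WithConv (A →ₗ[k] A) := toConv (Algebra.linearMap k A ∘ₗ f)

lemma eta_counit : eta (counit (R := k) (A := A)) = 1 := rfl

lemma mul_eta_apply (u : A →ₗ[k] A) (f : A →ₗ[k] k) (a : A) :
    (toConv u * eta f).ofConv a = u (applySnd k f (comul a)) := by
  change LinearMap.mul' k A (TensorProduct.map u (Algebra.linearMap k A ∘ₗ f) (comul a)) = _
  induction comul (R := k) a with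
  | zero => simp
  | add a b ha hb => simp only [map_add, ha, hb]
  | tmul p q => simp [← Algebra.commutes, ← Algebra.smul_def]

lemma eta_mul_apply (u : A →ₗ[k] A) (f : A →ₗ[k] k) (a : A) :
    (eta f * toConv u).ofConv a = u (applyFst k f (comul a)) := by
  change LinearMap.mul' k A (TensorProduct.map (Algebra.linearMap k A ∘ₗ f) u (comul a)) = _
  induction comul (R := k) a with
  | zero => simp
  | add a b ha hb => simp only [map_add, ha, hb]
  | tmul p q => simp [← Algebra.smul_def, applyFst]

lemma hom_mul_antipode (h : A →ₐ[k] A) :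
    toConv h.toLinearMap * toConv (h.toLinearMap ∘ₗ antipode k) = 1 := by
  have := LinearMap.algHom_comp_convMul_distrib h (toConv LinearMap.id) (toConv (antipode k (A := A)))
  rw [LinearMap.id_mul_antipode] at this
  ext a
  have h2 := LinearMap.congr_fun this a
  simpa using h2.symm

lemma antipode_mul_hom (h : A →ₐ[k] A) :
    toConv (h.toLinearMap ∘ₗ antipode k) * toConv h.toLinearMap = 1 := by
  have := LinearMap.algHom_comp_convMul_distrib h (toConv (antipode k (A := A))) (toConv LinearMap.id)
  rw [LinearMap.antipode_mul_id] at this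
  ext a
  have h2 := LinearMap.congr_fun this a
  simpa using h2.symm

/-- characters are invariant under the square of the antipode -/
lemma char_sq (f : A →ₐ[k] k) (a : A) : f (antipode k (antipode k a)) = f a := by
  let h : A →ₐ[k] A := (Algebra.ofId k A).comp f
  have h1 := hom_mul_antipode h
  have h2 : toConv (h.toLinearMap ∘ₗ antipode k)
      * toConv (h.toLinearMap ∘ₗ antipode k ∘ₗ antipode k) = 1 := by
    ext a
    have h3 := congrArg (fun z => h (antipode k z)) (mul_antipode_lTensor_comul_apply (R := k) a)
    have h4 : ∀ t : A ⊗[k] A, h (antipode k (LinearMap.mul' k A (LinearMap.lTensor A (antipode k) t)))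
      = LinearMap.mul' k A (TensorProduct.map (h.toLinearMap ∘ₗ antipode k)
          (h.toLinearMap ∘ₗ antipode k ∘ₗ antipode k) t) := by
      intro t
      induction t with
      | zero => simp
      | add a b ha hb => simp only [map_add, ha, hb]
      | tmul p q =>
        simp only [LinearMap.lTensor_tmul, LinearMap.mul'_apply, antipode_mul_antidistrib, map_mul,
          TensorProduct.map_tmul, LinearMap.comp_apply, AlgHom.toLinearMap_apply]
        simp only [h, AlgHom.comp_apply, Algebra.ofId_apply, ← map_mul]
        rw [map_mul f, map_mul f, mul_comm]
    simp only [h4] at h3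
    change LinearMap.mul' k A (TensorProduct.map _ _ (comul a)) = _
    rw [h3]
    simp [Algebra.algebraMap_eq_smul_one]
  have h5 := left_inv_eq_right_inv h1 h2
  have h6 := LinearMap.congr_fun (congrArg ofConv h5) a
  simp [h] at h6
  have : Function.Injective (algebraMap k A) := by
    intro c d hcd
    simpa using congrArg (counit (R := k)) hcd
  exact (this h6).symm

/-- conclusion of the work on `A` -/
lemma modular_facts (φ : A →ₗ[k] k)
    (hφ : ∀ a : A, applySnd k φ (comul a) = φ a • (1 : A))
    (hf : ∀ a : A, (∀ b : A, φ (b * a) = 0) → a = 0)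
    (σ : A ≃ₐ[k] A) (hσ : ∀ a b : A, φ (a * b) = φ (b * σ a)) :
    eta (counit ∘ₗ σ.toLinearMap) * eta (counit ∘ₗ σ.symm.toLinearMap) = 1 ∧
    toConv σ.toLinearMap * eta (counit ∘ₗ σ.symm.toLinearMap)
      = toConv (antipode k ∘ₗ antipode k) ∧
    toConv (σ.toLinearMap ∘ₗ antipode k) = eta (counit ∘ₗ σ.symm.toLinearMap)
      * toConv (antipode k ∘ₗ antipode k ∘ₗ antipode k) := by
  set f : A →ₐ[k] k := (Bialgebra.counitAlgHom k A).comp σ.toAlgHom with hfdef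
  set g : A →ₐ[k] k := (Bialgebra.counitAlgHom k A).comp σ.symm.toAlgHom with hgdef
  have ef : counit ∘ₗ σ.toLinearMap = f.toLinearMap := rfl
  have eg : counit ∘ₗ σ.symm.toLinearMap = g.toLinearMap := rfl
  rw [ef, eg]
  -- σ = S² * f
  have h1 : toConv σ.toLinearMap = toConv (antipode k ∘ₗ antipode k) * eta f.toLinearMap := by
    ext a
    rw [mul_eta_apply]
    have := congrArg (applySnd k counit) (comul_modular φ hφ hf σ hσ a)
    rw [applySnd_map, ef] at this
    rw [← this]
    simp [applySnd]
  have h2 : eta g.toLinearMap * eta f.toLinearMap = 1 := by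
    ext a
    have h3 := LinearMap.congr_fun (congrArg ofConv h1) a
    rw [mul_eta_apply] at h3
    rw [eta, mul_eta_apply]
    have h4 := congrArg g h3
    simp only [LinearMap.comp_apply, char_sq] at h4
    simp only [LinearMap.comp_apply, AlgHom.toLinearMap_apply]
    rw [← h4]
    simp [hgdef]
  have h3 : eta f.toLinearMap * eta g.toLinearMap = 1 := by
    have h4 := hom_mul_antipode ((Algebra.ofId k A).comp f)
    have h5 : toConv ((Algebra.ofId k A).comp f).toLinearMap = eta f.toLinearMap := rfl
    rw [h5] at h4
    rw [left_inv_eq_right_inv h2 h4, h4]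
  refine ⟨h3, ?_, ?_⟩
  · rw [h1, mul_assoc, h3, mul_one]
  · let s2 : A →ₐ[k] A := AlgHom.ofLinearMap (antipode k ∘ₗ antipode k) (by simp)
      (by intro x y; simp [antipode_mul_antidistrib])
    have h4 := antipode_mul_hom s2
    have h5 := hom_mul_antipode σ.toAlgHom
    have e2 : s2.toLinearMap = antipode k ∘ₗ antipode k := rfl
    rw [e2] at h4
    have e3 : σ.toAlgHom.toLinearMap = σ.toLinearMap := rfl
    rw [e3] at h5
    refine (left_inv_eq_right_inv ?_ h5).symm
    rw [h1, mul_assoc, ← mul_assoc (toConv (antipode k ∘ₗ antipode k ∘ₗ antipode k))]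
    rw [show (antipode k ∘ₗ antipode k ∘ₗ antipode k : A →ₗ[k] A) 
      = (antipode k ∘ₗ antipode k) ∘ₗ antipode k from rfl, h4, one_mul, h2]

end hopf

section galois
variable {k : Type*} [Field k] {A X : Type*} [Ring A] [HopfAlgebra k A]
    [Ring X] [Algebra k X] (G : GaloisContext k A X)

lemma lTensor_R (u : A →ₗ[k] A) (g : A →ₗ[k] k) (x : X) :
    LinearMap.lTensor X u (G.α (applySnd k g (G.α x)))
      = LinearMap.lTensor X (toConv u * eta g).ofConv (G.α x) := by
  have h1 : ∀ t : X ⊗[k] A, G.α (applySnd k g t)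
      = LinearMap.lTensor X (applySnd k g)
        (TensorProduct.assoc k X A A (LinearMap.rTensor A G.α.toLinearMap t)) := by
    intro t
    induction t with
    | zero => simp
    | add a b ha hb => simp only [map_add, ha, hb]
    | tmul p q =>
      simp only [applySnd_tmul, LinearMap.rTensor_tmul, AlgHom.toLinearMap_apply, map_smul]
      induction G.α p with
      | zero => simp
      | add a b ha hb => simp only [map_add, TensorProduct.add_tmul, smul_add, ha, hb]
      | tmul c d => simp
  rw [h1, G.coassoc]
  induction G.α x with
  | zero => simp
  | add a b ha hb => simp only [map_add, ha, hb]
  | tmul p q => simp only [LinearMap.lTensor_tmul, mul_eta_apply]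

lemma map_R (u : A →ₗ[k] A) (g : A →ₗ[k] k) (x : X) :
    TensorProduct.map (applySnd k g ∘ₗ G.α.toLinearMap) u (G.α x)
      = LinearMap.lTensor X (eta g * toConv u).ofConv (G.α x) := by
  have h1 : ∀ t : X ⊗[k] A, TensorProduct.map (applySnd k g ∘ₗ G.α.toLinearMap) u t
      = LinearMap.lTensor X (u ∘ₗ applyFst k g)
        (TensorProduct.assoc k X A A (LinearMap.rTensor A G.α.toLinearMap t)) := by
    intro t
    induction t with
    | zero => simp
    | add a b ha hb => simp only [map_add, ha, hb]
    | tmul p q =>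
      simp only [TensorProduct.map_tmul, LinearMap.comp_apply, LinearMap.rTensor_tmul,
        AlgHom.toLinearMap_apply]
      induction G.α p with
      | zero => simp
      | add a b ha hb => simp only [map_add, TensorProduct.add_tmul, ha, hb]
      | tmul c d => simp [applyFst, TensorProduct.smul_tmul]
  rw [h1, G.coassoc]
  induction G.α x with
  | zero => simp
  | add a b ha hb => simp only [map_add, ha, hb]
  | tmul p q => simp only [LinearMap.lTensor_tmul, eta_mul_apply, LinearMap.comp_apply]

lemma V_tmul (y z : X) : G.V (y ⊗ₜ z) = (y ⊗ₜ 1) * G.α z := by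
  simp [GaloisContext.V, galoisV]

lemma V_β (a : A) : G.V (G.β a) = 1 ⊗ₜ a := by
  simp [GaloisContext.β]

lemma β_colinear (a : A) :
    LinearMap.lTensor X G.α.toLinearMap (G.β a)
      = TensorProduct.assoc k X X A (LinearMap.rTensor A G.β (comul a)) := by
  have h1 : ∀ t : X ⊗[k] X, TensorProduct.assoc k X A A (LinearMap.rTensor A G.V.toLinearMap
      ((TensorProduct.assoc k X X A).symm (LinearMap.lTensor X G.α.toLinearMap t)))
      = LinearMap.lTensor X comul (G.V t) := by
    intro t
    induction t with
    | zero => simp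
    | add a b ha hb => simp only [map_add, ha, hb]
    | tmul y z =>
      have h2 : ∀ s : X ⊗[k] A, LinearMap.lTensor X (comul (R := k)) ((y ⊗ₜ[k] (1 : A)) * s)
          = (y ⊗ₜ[k] (1 : A ⊗[k] A)) * LinearMap.lTensor X comul s := by
        intro s
        induction s with
        | zero => simp
        | add a b ha hb => simp only [map_add, mul_add, ha, hb]
        | tmul p q => simp
      rw [V_tmul, h2, ← G.coassoc]
      simp only [LinearMap.lTensor_tmul, AlgHom.toLinearMap_apply]
      induction G.α z with
      | zero => simp
      | add a b ha hb => simp only [map_add, TensorProduct.tmul_add, mul_add, ha, hb]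
      | tmul p q =>
        simp only [TensorProduct.assoc_symm_tmul, LinearMap.rTensor_tmul, LinearEquiv.coe_coe, V_tmul,
          AlgHom.toLinearMap_apply]
        induction G.α p with
        | zero => simp
        | add a b ha hb => simp only [map_add, TensorProduct.add_tmul, mul_add, ha, hb]
        | tmul c d => simp
  rw [← LinearEquiv.symm_apply_eq]
  have hinj : Function.Injective (LinearMap.rTensor A G.V.toLinearMap) :=
    (LinearEquiv.rTensor A G.V).injective
  apply hinj
  apply (TensorProduct.assoc k X A A).injective
  rw [h1, V_β]
  simp only [LinearMap.lTensor_tmul]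
  induction comul (R := k) a with
  | zero => simp
  | add a b ha hb => simp only [map_add, TensorProduct.tmul_add, ha, hb]
  | tmul p q => simp [V_β]

/-- the Miyashita-Ulbrich action -/
noncomputable def T : X ⊗[k] A →ₗ[k] X :=
  LinearMap.mul' k X ∘ₗ LinearMap.lTensor X (LinearMap.mul' k X) ∘ₗ
    (TensorProduct.leftComm k X X X).toLinearMap ∘ₗ LinearMap.lTensor X G.β

noncomputable def theta' : X →ₗ[k] X :=
  T G ∘ₗ LinearMap.lTensor X (antipode k) ∘ₗ G.α.toLinearMap

lemma applySnd_left_mul (φ : A →ₗ[k] k) (y : X) (w : X ⊗[k] A) :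
    applySnd k φ ((y ⊗ₜ 1) * w) = y * applySnd k φ w := by
  induction w with
  | zero => simp
  | add a b ha hb => simp only [map_add, mul_add, ha, hb]
  | tmul p q => simp

lemma key1 (φX : X →ₗ[k] k) (hφX : ∀ x : X, applySnd k G.φ (G.α x) = φX x • (1 : X)) 
    (z : X) (t : X ⊗[k] X) :
    applySnd k (φX ∘ₗ LinearMap.mulRight k z) t = applySnd k G.φ (G.V t * G.α z) := by
  induction t with
  | zero => simp
  | add a b ha hb => simp only [map_add, add_mul, ha, hb]
  | tmul y' y =>
    rw [V_tmul, mul_assoc, ← map_mul, applySnd_left_mul, hφX]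
    simp

lemma key2 (φX : X →ₗ[k] k) (hφX : ∀ x : X, applySnd k G.φ (G.α x) = φX x • (1 : X)) 
    (x : X) (t : X ⊗[k] X) :
    applySnd k (φX ∘ₗ LinearMap.mulLeft k x) t
      = LinearMap.mul' k X (LinearMap.lTensor X (applySnd k G.φ ∘ₗ LinearMap.mulLeft k (G.α x))
          (LinearMap.lTensor X G.α.toLinearMap t)) := by
  induction t with
  | zero => simp
  | add a b ha hb => simp only [map_add, ha, hb]
  | tmul y' y =>
    simp only [LinearMap.lTensor_tmul, LinearMap.comp_apply, AlgHom.toLinearMap_apply,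
      LinearMap.mulLeft_apply, ← map_mul, hφX]
    simp

lemma key3 (a : A) (w : X ⊗[k] A) :
    LinearMap.mul' k X (LinearMap.lTensor X (applySnd k G.φ ∘ₗ LinearMap.mulLeft k w)
          (LinearMap.lTensor X G.α.toLinearMap (G.β a)))
      = T G (LinearMap.lTensor X (antipode k ∘ₗ applySnd k (G.φ ∘ₗ LinearMap.mulRight k a))
          (LinearMap.lTensor X comul w)) := by
  rw [β_colinear]
  induction w with
  | zero => simp
  | add u v hu hv =>
    have e : LinearMap.mulLeft k (u + v) = LinearMap.mulLeft k u + LinearMap.mulLeft k v := by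
      ext; simp [add_mul]
    simp only [map_add, ← hu, ← hv]
    rw [e, LinearMap.comp_add, LinearMap.lTensor_add, LinearMap.add_apply, map_add]
  | tmul p q =>
    simp only [LinearMap.lTensor_tmul, LinearMap.comp_apply]
    rw [← strong_inv G.φ G.φ_integral]
    induction comul (R := k) a with
    | zero => simp
    | add a b ha hb => simp only [map_add, TensorProduct.tmul_add, ha, hb]
    | tmul c d =>
      simp only [LinearMap.rTensor_tmul, applySnd_tmul, T, LinearMap.comp_apply,
        LinearMap.lTensor_tmul, map_smul, TensorProduct.tmul_smul]
      induction G.β c with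
      | zero => simp
      | add a b ha hb => 
        simp only [map_add, TensorProduct.add_tmul, TensorProduct.tmul_add, smul_add, ha, hb]
      | tmul y' y => simp

lemma key4 (a : A) (x : X) :
    T G (LinearMap.lTensor X (antipode k ∘ₗ applySnd k (G.φ ∘ₗ LinearMap.mulRight k a))
          (LinearMap.lTensor X comul (G.α x)))
      = theta' G (applySnd k (G.φ ∘ₗ LinearMap.mulRight k a) (G.α x)) := by
  rw [← G.coassoc]
  induction G.α x with
  | zero => simp
  | add a b ha hb => simp only [map_add, ha, hb]
  | tmul p q =>
    simp only [LinearMap.rTensor_tmul, AlgHom.toLinearMap_apply, applySnd_tmul, map_smul, theta',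
      LinearMap.comp_apply]
    induction G.α p with
    | zero => simp
    | add a b ha hb => simp only [map_add, TensorProduct.add_tmul, smul_add, ha, hb]
    | tmul c d => simp

lemma theta'_key (φX : X →ₗ[k] k)
    (hφX : ∀ x : X, applySnd k G.φ (G.α x) = φX x • (1 : X))
    (σ : A ≃ₐ[k] A) (hσ : ∀ a b : A, G.φ (a * b) = G.φ (b * σ a))
    (σX : X ≃ₐ[k] X) (hσX : ∀ x y : X, φX (y * σX x) = φX (x * y)) (x : X) :
    G.α (σX x) = TensorProduct.map (theta' G) σ.toLinearMap (G.α x) := by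
  apply separation G.φ G.φ_faithful_right
  intro a
  have e2 : (G.φ ∘ₗ LinearMap.mulLeft k a) ∘ₗ σ.toLinearMap = G.φ ∘ₗ LinearMap.mulRight k a := by
    ext c; simp [hσ c a]
  rw [applySnd_map, e2, ← key4, ← key3, ← key2 G φX hφX]
  have e3 : φX ∘ₗ LinearMap.mulLeft k x = φX ∘ₗ LinearMap.mulRight k (σX x) := by
    ext c; simp [hσX]
  rw [e3, key1 G φX hφX, V_β]
  induction G.α (σX x) with
  | zero => simp
  | add a b ha hb => simp only [map_add, mul_add, ha, hb]
  | tmul c d => simp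

lemma thetaX_key (φX : X →ₗ[k] k)
    (hφX : ∀ x : X, applySnd k G.φ (G.α x) = φX x • (1 : X))
    (σ : A ≃ₐ[k] A) (hσ : ∀ a b : A, G.φ (a * b) = G.φ (b * σ a))
    (σX : X ≃ₐ[k] X) (hσX : ∀ x y : X, φX (y * σX x) = φX (x * y))
    (hfg : eta (counit (R := k) ∘ₗ σ.toLinearMap) * eta (counit ∘ₗ σ.symm.toLinearMap) = 1) (x : X) :
    G.α (σX x) = TensorProduct.map (thetaX G σ σX) σ.toLinearMap (G.α x) := by
  have h := theta'_key G φX hφX σ hσ σX hσX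
  suffices thetaX G σ σX = theta' G by rw [this]; exact h x
  have h2 : ∀ x, σX x = theta' G (applySnd k (counit ∘ₗ σ.toLinearMap) (G.α x)) := by
    intro x
    rw [← applySnd_map, ← h, G.counit_id]
  ext x
  change σX (applySnd k (counit ∘ₗ σ.symm.toLinearMap) (G.α x)) = _
  rw [h2]
  congr 1
  have h3 := lTensor_R G (Algebra.linearMap k A ∘ₗ (counit ∘ₗ σ.toLinearMap))
    (counit ∘ₗ σ.symm.toLinearMap) x
  rw [show toConv (Algebra.linearMap k A ∘ₗ (counit ∘ₗ σ.toLinearMap))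
    = eta (counit ∘ₗ σ.toLinearMap) from rfl, hfg] at h3
  have h4 := congrArg (applySnd k counit) h3
  have h5 : ∀ (f : A →ₗ[k] k) (t : X ⊗[k] A), applySnd k counit
      (LinearMap.lTensor X (Algebra.linearMap k A ∘ₗ f) t) = applySnd k f t := by
    intro f t
    induction t with
    | zero => simp
    | add a b ha hb => simp only [map_add, ha, hb]
    | tmul c d => simp
  rw [h5, show (1 : WithConv (A →ₗ[k] A)).ofConv = Algebra.linearMap k A ∘ₗ counit from rfl, h5,
    G.counit_id] at h4
  exact h4

end galois

end GalAux

theorem galois_object_thetaX_coaction_formulas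
    {k : Type*} [Field k] {A X : Type*} [Ring A] [HopfAlgebra k A]
    [Ring X] [Algebra k X] [Nontrivial X]
    (G : GaloisContext k A X)
    (φX : X →ₗ[k] k)
    (hφX : ∀ x : X, applySnd k G.φ (G.α x) = φX x • (1 : X))
    (σ : A ≃ₐ[k] A) (hσ : ∀ a b : A, G.φ (a * b) = G.φ (b * σ a))
    (σ' : A ≃ₐ[k] A)
    (hσ' : ∀ a b : A, G.φ (HopfAlgebra.antipode (R := k) (A := A) (a * b))
      = G.φ (HopfAlgebra.antipode (R := k) (A := A) (b * σ' a)))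
    (σX : X ≃ₐ[k] X) (hσX : ∀ x y : X, φX (y * σX x) = φX (x * y)) :
    (∀ x : X, G.α (σX x)
        = TensorProduct.map (thetaX G σ σX) σ.toLinearMap (G.α x)) ∧
    (∀ x : X, G.α (thetaX G σ σX x)
        = TensorProduct.map (thetaX G σ σX)
            (HopfAlgebra.antipode (R := k) (A := A) ∘ₗ HopfAlgebra.antipode (R := k) (A := A))
            (G.α x)) ∧
    (∀ x : X, G.α (thetaX G σ σX x)
        = TensorProduct.map σX.toLinearMap σ'.symm.toLinearMap (G.α x)) := by
  obtain ⟨hfg, hσg, hσS⟩ := GalAux.modular_facts G.φ G.φ_integral G.φ_faithful_right σ hσ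
  have h1 := GalAux.thetaX_key G φX hφX σ hσ σX hσX hfg
  have h2 : ∀ x : X, G.α (thetaX G σ σX x)
        = TensorProduct.map (thetaX G σ σX)
            (HopfAlgebra.antipode (R := k) (A := A) ∘ₗ HopfAlgebra.antipode (R := k) (A := A))
            (G.α x) := by
    intro x
    have e : thetaX G σ σX x = σX (applySnd k (Coalgebra.counit ∘ₗ σ.symm.toLinearMap) (G.α x)) := rfl
    have e2 : ∀ (u : A →ₗ[k] A) (t : X ⊗[k] A), TensorProduct.map (thetaX G σ σX) u t
        = LinearMap.rTensor A (thetaX G σ σX) (LinearMap.lTensor X u t) := by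
      intro u t
      rw [← LinearMap.comp_apply, LinearMap.rTensor_comp_lTensor]
    rw [e, h1, e2, e2]
    rw [GalAux.lTensor_R G, hσg]
  refine ⟨h1, h2, ?_⟩
  intro x
  rw [h2]
  have e : thetaX G σ σX = σX.toLinearMap ∘ₗ
    (applySnd k (Coalgebra.counit ∘ₗ σ.symm.toLinearMap) ∘ₗ G.α.toLinearMap) := rfl
  have e2 : ∀ (v : X →ₗ[k] X) (u : A →ₗ[k] A) (t : X ⊗[k] A),
      TensorProduct.map (σX.toLinearMap ∘ₗ v) u t
        = LinearMap.rTensor A σX.toLinearMap (TensorProduct.map v u t) := by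
    intro v u t
    rw [← LinearMap.comp_apply, LinearMap.rTensor_comp_map]
  rw [e, e2, GalAux.map_R G]
  have e3 : (GalAux.eta (Coalgebra.counit ∘ₗ σ.symm.toLinearMap) * WithConv.toConv
      (HopfAlgebra.antipode (R := k) (A := A) ∘ₗ HopfAlgebra.antipode (R := k) (A := A))).ofConv
      = σ'.symm.toLinearMap := by
    ext a
    apply G.antipode_bijective.1
    have h3 := LinearMap.congr_fun (congrArg WithConv.ofConv hσS) a
    rw [GalAux.eta_mul_apply] at h3 ⊢
    simp only [LinearMap.comp_apply, AlgEquiv.toLinearMap_apply] at h3 ⊢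
    rw [← h3]
    have h4 : ∀ c : A, HopfAlgebra.antipode k c = σ (HopfAlgebra.antipode k (σ' c)) := by
      intro c
      rw [← sub_eq_zero]
      apply G.φ_faithful_right
      intro b
      obtain ⟨b, rfl⟩ := G.antipode_bijective.2 b
      have h5 := hσ' c b
      rw [HopfAlgebra.antipode_mul_antidistrib, HopfAlgebra.antipode_mul_antidistrib, hσ (HopfAlgebra.antipode k (σ' c))] at h5
      rw [mul_sub, map_sub, h5, sub_self]
    have h6 := h4 (σ'.symm a)
    rw [σ'.apply_symm_apply] at h6
    exact h6.symm
  rw [e3, ← LinearMap.comp_apply, LinearMap.rTensor_comp_lTensor]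
end
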